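/- Let d ≥ 2, γ > −1, q ≥ 1, let k_1,…,k_q be distinct integers in {1,…,d+1}, let 2 ≤ p ≤ d, a > 0 with a ≠ 1, and let A_1,…,A_{q+1} ∈ ℝ. Suppose w_γ ∫_{𝒯^{d+1}} f(ξ) ξ^γ dξ = Σ_{j=1}^q A_j · avg_{v_{k_j}𝒜_d} f + A_{q+1} · avg_{u_{a,p}𝒜_d} f holds for every homogeneous polynomial f of degree 6 in d+1 variables. Then the following four relations hold: p·A_{q+1}·a(a−1)²(a+1)² = m_{(5,1)} − 2 m_{(3,3)}; p·A_{q+1}·a²(a−1)² = m_{(4,2)} − 2 m_{(3,3)}; −2 A_{q+1} a(a−1)²(a+1)·C(p,2) = m_{(3,2,1)} − 2 m_{(4,1,1)}; and 2 A_{q+1} a(a−1)²·C(p,2) = m_{(3,2,1)} − 6 m_{(2,2,2)}, where C(p,2) = p(p−1)/2. -/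

import Mathlib

open MeasureTheory Finset

/-- The standard simplex `T^d` in `ℝ^d`. -/
def Td (d : ℕ) : Set (Fin d → ℝ) :=
  {x | (∀ i, 0 ≤ x i) ∧ ∑ i, x i ≤ 1}

/-- The weight function `W_γ(x) = (x_1 ⋯ x_d (1 - |x|₁))^γ` on `T^d`. -/
noncomputable def Wg (d : ℕ) (γ : ℝ) (x : Fin d → ℝ) : ℝ :=
  ((∏ i, x i) * (1 - ∑ i, x i)) ^ γ

/-- The normalization constant `w_γ = Γ((d+1)(γ+1)) / Γ(γ+1)^(d+1)`. -/
noncomputable def wg (d : ℕ) (γ : ℝ) : ℝ :=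
  Real.Gamma ((d + 1) * (γ + 1)) / (Real.Gamma (γ + 1)) ^ (d + 1)

/-- Homogeneous coordinates: `x ↦ (x, 1 - |x|₁) ∈ 𝒯^{d+1}`. -/
noncomputable def lift (d : ℕ) (x : Fin d → ℝ) : Fin (d + 1) → ℝ :=
  Fin.snoc x (1 - ∑ i, x i)

/-- Evaluation of the monomial symmetric polynomial with exponent vector `lv`:
the sum of all distinct monomials whose exponent vector is a permutation of `lv`. -/
noncomputable def msymmEval (d : ℕ) (lv : Fin (d + 1) → ℕ) (x : Fin (d + 1) → ℝ) : ℝ :=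
  ∑ β ∈ Finset.image (fun σ : Equiv.Perm (Fin (d + 1)) => lv ∘ σ) Finset.univ,
    ∏ i, x i ^ β i

/-- Pad a list of exponents (a partition) into an exponent vector in `d+1` variables. -/
def pvec (d : ℕ) (l : List ℕ) : Fin (d + 1) → ℕ :=
  fun i => l.getD (i : ℕ) 0

/-- The moment `m_ℓ := w_γ ∫_{𝒯^{d+1}} S_ℓ(ξ) ξ^γ dξ`. -/
noncomputable def momentS (d : ℕ) (γ : ℝ) (lv : Fin (d + 1) → ℕ) : ℝ :=
  wg d γ * ∫ x in Td d, msymmEval d lv (lift d x) * Wg d γ x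

/-- The average of `f` over the set of distinct coordinate permutations of `y`. -/
noncomputable def orbitAvg (d : ℕ) (y : Fin (d + 1) → ℝ) (f : (Fin (d + 1) → ℝ) → ℝ) : ℝ :=
  ((Finset.image (fun σ : Equiv.Perm (Fin (d + 1)) => y ∘ σ) Finset.univ).card : ℝ)⁻¹ *
    ∑ z ∈ Finset.image (fun σ : Equiv.Perm (Fin (d + 1)) => y ∘ σ) Finset.univ, f z

/-- `v_k = (1,…,1,0,…,0)` with `k` ones, in `d+1` coordinates. -/
def vk (d k : ℕ) : Fin (d + 1) → ℝ :=
  fun i => if (i : ℕ) < k then 1 else 0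

/-- `u_{a,p} = (a,1,…,1,0,…,0)` with one entry `a` followed by `p` ones. -/
def uap (d : ℕ) (a : ℝ) (p : ℕ) : Fin (d + 1) → ℝ :=
  fun i => if (i : ℕ) = 0 then a else if (i : ℕ) ≤ p then 1 else 0

section EmbeddingSums

variable {ι : Type*}

/-- The sum over all injective choices of `m` variables of the monomials with exponents `r`. -/
noncomputable def embSum [Fintype ι] (m : ℕ) (x : ι → ℝ) (r : Fin m → ℕ) : ℝ :=
  ∑ e : Fin m ↪ ι, ∏ s, x (e s) ^ r s

lemma embSum_zero [Fintype ι] (x : ι → ℝ) (r : Fin 0 → ℕ) : embSum 0 x r = 1 := by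
  simp [embSum]

lemma embSum_succ [Fintype ι] [DecidableEq ι] (m : ℕ) (x : ι → ℝ) (r : Fin (m + 1) → ℕ) :
    embSum (m + 1) x r = embSum m x (Fin.tail r) * ∑ i, x i ^ r 0
      - ∑ s, embSum m x (Function.update (Fin.tail r) s (Fin.tail r s + r 0)) := by
  have hupd (e : Fin m ↪ ι) (s : Fin m) :
      ∏ t, x (e t) ^ Function.update (Fin.tail r) s (Fin.tail r s + r 0) t
        = (∏ t, x (e t) ^ Fin.tail r t) * x (e s) ^ r 0 := by
    rw [← Finset.mul_prod_erase univ _ (mem_univ s),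
      ← Finset.mul_prod_erase univ (fun t => x (e t) ^ Fin.tail r t) (mem_univ s),
      Function.update_self, pow_add]
    have : ∏ t ∈ univ.erase s, x (e t) ^ Function.update (Fin.tail r) s (Fin.tail r s + r 0) t
        = ∏ t ∈ univ.erase s, x (e t) ^ Fin.tail r t :=
      prod_congr rfl fun t ht => by rw [Function.update_of_ne (ne_of_mem_erase ht)]
    rw [this]
    ring
  have hcompl (e : Fin m ↪ ι) :
      ∑ i : {i // i ∉ Set.range e}, x i ^ r 0 = ∑ i, x i ^ r 0 - ∑ s, x (e s) ^ r 0 := by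
    have h1 : ∑ i : {i // i ∉ Set.range e}, x i ^ r 0 = ∑ i ∈ (univ.map e)ᶜ, x i ^ r 0 :=
      (Finset.sum_subtype _ (by simp) fun i => x i ^ r 0).symm
    rw [h1, ← Finset.sum_compl_add_sum (univ.map e), Finset.sum_map]
    ring
  unfold embSum
  rw [Finset.sum_comm, Finset.sum_mul, ← Finset.sum_sub_distrib,
    ← Equiv.sum_comp (Equiv.embeddingFinSucc m ι).symm, Fintype.sum_sigma]
  refine sum_congr rfl fun e _ => ?_
  simp only [hupd, Equiv.coe_embeddingFinSucc_symm, Fin.prod_univ_succ, Fin.cons_zero,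
    Fin.cons_succ]
  rw [← Finset.sum_mul, hcompl, ← Finset.mul_sum]
  simp only [Fin.tail]
  ring

lemma prod_pow_extend [Fintype ι] {m : ℕ} (x : ι → ℝ) (e : Fin m ↪ ι) (r : Fin m → ℕ) :
    ∏ i, x i ^ Function.extend e r 0 i = ∏ s, x (e s) ^ r s := by
  rw [← Finset.prod_subset (subset_univ (univ.map e)), Finset.prod_map]
  · simp [e.injective.extend_apply]
  · intro i _ hi
    rw [Function.extend_apply' _ _ _ (by simpa using hi)]
    simp

lemma exists_perm_of_extend_eq {m : ℕ} {r : Fin m → ℕ} (hr : ∀ s, r s ≠ 0) {e e' : Fin m ↪ ι}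
    (h : Function.extend e' r 0 = Function.extend e r 0) :
    ∃ τ : Equiv.Perm (Fin m), r ∘ τ = r ∧ τ.toEmbedding.trans e = e' := by
  have hmem (s : Fin m) : ∃ t, e t = e' s := by
    by_contra hs
    have := congrFun h (e' s)
    rw [e'.injective.extend_apply, Function.extend_apply' _ _ _ hs] at this
    exact hr s this
  choose τ hτ using hmem
  have hinj : Function.Injective τ := fun s t hst => e'.injective (by rw [← hτ, ← hτ, hst])
  refine ⟨Equiv.ofBijective τ (Finite.injective_iff_bijective.1 hinj), ?_, ?_⟩
  · ext s
    have := congrFun h (e' s)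
    rw [e'.injective.extend_apply, ← hτ, e.injective.extend_apply] at this
    exact this.symm
  · ext s
    simp [hτ]

lemma card_filter_extend_eq [Fintype ι] [DecidableEq ι] {m : ℕ} {r : Fin m → ℕ}
    (hr : ∀ s, r s ≠ 0) (e : Fin m ↪ ι) :
    #{e' : Fin m ↪ ι | Function.extend e' r 0 = Function.extend e r 0}
      = #{τ : Equiv.Perm (Fin m) | r ∘ τ = r} := by
  symm
  refine Finset.card_bij (fun τ _ => τ.toEmbedding.trans e) ?_ ?_ ?_
  · intro τ hτ
    simp only [mem_filter, mem_univ, true_and] at hτ ⊢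
    ext i
    by_cases hi : ∃ s, e s = i
    · obtain ⟨s, rfl⟩ := hi
      have hs : (τ.toEmbedding.trans e) (τ.symm s) = e s := by simp
      rw [← hs, (τ.toEmbedding.trans e).injective.extend_apply, hs, e.injective.extend_apply]
      simpa using (congrFun hτ (τ.symm s)).symm
    · rw [Function.extend_apply' _ _ _ hi, Function.extend_apply']
      rintro ⟨s, rfl⟩
      exact hi ⟨τ s, rfl⟩
  · intro τ _ τ' _ h
    ext s
    have := DFunLike.congr_fun h s
    simpa using congrArg Fin.val (e.injective this)
  · intro e' he'
    obtain ⟨τ, hτ, rfl⟩ := exists_perm_of_extend_eq hr (mem_filter.1 he').2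
    exact ⟨τ, by simpa using hτ, rfl⟩

lemma image_perm_extend [Fintype ι] [DecidableEq ι] {m : ℕ} (r : Fin m → ℕ) (e₀ : Fin m ↪ ι) :
    univ.image (fun σ : Equiv.Perm ι => Function.extend e₀ r 0 ∘ σ)
      = univ.image (fun e : Fin m ↪ ι => Function.extend e r 0) := by
  have key (e : Fin m ↪ ι) (σ : Equiv.Perm ι) (h : ∀ s, σ (e s) = e₀ s) :
      Function.extend e₀ r 0 ∘ σ = Function.extend e r 0 := by
    ext i
    by_cases hi : ∃ s, e s = i
    · obtain ⟨s, rfl⟩ := hi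
      rw [Function.comp_apply, h, e₀.injective.extend_apply, e.injective.extend_apply]
    · rw [Function.comp_apply, Function.extend_apply' _ _ _ hi, Function.extend_apply']
      · rfl
      · rintro ⟨s, hs⟩
        exact hi ⟨s, σ.injective (by rw [h, hs])⟩
  ext β
  simp only [mem_image, mem_univ, true_and]
  constructor
  · rintro ⟨σ, rfl⟩
    exact ⟨e₀.trans σ.symm.toEmbedding, (key _ σ (by simp)).symm⟩
  · rintro ⟨e, rfl⟩
    obtain ⟨σ, hσ⟩ := Equiv.Perm.exists_extending_pair e e₀ e.injective e₀.injective
    exact ⟨σ, key e σ hσ⟩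

lemma card_mul_sum_image_extend [Fintype ι] [DecidableEq ι] {m : ℕ} {r : Fin m → ℕ}
    (hr : ∀ s, r s ≠ 0) (e₀ : Fin m ↪ ι) (x : ι → ℝ) :
    (#{τ : Equiv.Perm (Fin m) | r ∘ τ = r} : ℝ) *
      ∑ β ∈ univ.image (fun σ : Equiv.Perm ι => Function.extend e₀ r 0 ∘ σ), ∏ i, x i ^ β i
      = embSum m x r := by
  have h := Finset.sum_comp (s := (univ : Finset (Fin m ↪ ι)))
    (fun β : ι → ℕ => ∏ i, x i ^ β i) (fun e => Function.extend e r 0)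
  simp only [prod_pow_extend] at h
  rw [embSum, h, image_perm_extend, Finset.mul_sum]
  refine sum_congr rfl fun β hβ => ?_
  obtain ⟨e, -, rfl⟩ := mem_image.1 hβ
  rw [card_filter_extend_eq hr, nsmul_eq_mul]

end EmbeddingSums

lemma card_mul_msymmEval_pvec {d : ℕ} (l : List ℕ) (hl : l.length ≤ d + 1) (hr : ∀ s, l.get s ≠ 0)
    (x : Fin (d + 1) → ℝ) :
    (#{τ : Equiv.Perm (Fin l.length) | l.get ∘ τ = l.get} : ℝ) * msymmEval d (pvec d l) x
      = embSum l.length x l.get := by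
  have hp : pvec d l = Function.extend (Fin.castLEEmb hl) l.get 0 := by
    ext i
    by_cases hi : (i : ℕ) < l.length
    · have : i = Fin.castLEEmb hl ⟨i, hi⟩ := rfl
      rw [this, (Fin.castLEEmb hl).injective.extend_apply]
      simp [pvec, hi]
    · rw [Function.extend_apply']
      · simp [pvec, not_lt.1 hi]
      · rintro ⟨s, rfl⟩
        exact hi s.2
  rw [msymmEval, hp]
  exact card_mul_sum_image_extend hr _ x

/-- The power sum `∑ i, x i ^ n`. -/
noncomputable def powerSum {ι : Type*} [Fintype ι] (x : ι → ℝ) (n : ℕ) : ℝ := ∑ i, x i ^ n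

lemma embSum_two {ι : Type*} [Fintype ι] [DecidableEq ι] (x : ι → ℝ) (a b : ℕ) :
    embSum 2 x ![a, b] = powerSum x a * powerSum x b - powerSum x (a + b) := by
  simp [embSum_succ, embSum_zero, powerSum, Fin.tail, add_comm b a, mul_comm]

lemma embSum_three {ι : Type*} [Fintype ι] [DecidableEq ι] (x : ι → ℝ) (a b c : ℕ) :
    embSum 3 x ![a, b, c] = powerSum x a * powerSum x b * powerSum x c
      - powerSum x (a + b) * powerSum x c - powerSum x (a + c) * powerSum x b
      - powerSum x (b + c) * powerSum x a + 2 * powerSum x (a + b + c) := by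
  simp [embSum_succ, embSum_zero, powerSum, Fin.tail, Fin.sum_univ_succ]
  ring_nf

lemma card_mul_msymmEval_pair {d : ℕ} (hd : 2 ≤ d) (a b : ℕ) (ha : a ≠ 0) (hb : b ≠ 0)
    (x : Fin (d + 1) → ℝ) :
    (#{τ : Equiv.Perm (Fin 2) | ![a, b] ∘ τ = ![a, b]} : ℝ) * msymmEval d (pvec d [a, b]) x
      = powerSum x a * powerSum x b - powerSum x (a + b) := by
  rw [← embSum_two]
  have hg : [a, b].get = ![a, b] := by ext s; fin_cases s <;> rfl
  have h := card_mul_msymmEval_pvec (d := d) [a, b] (by simp; omega)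
    (by intro s; fin_cases s <;> simpa) x
  rwa [hg] at h

lemma card_mul_msymmEval_triple {d : ℕ} (hd : 2 ≤ d) (a b c : ℕ) (ha : a ≠ 0) (hb : b ≠ 0)
    (hc : c ≠ 0) (x : Fin (d + 1) → ℝ) :
    (#{τ : Equiv.Perm (Fin 3) | ![a, b, c] ∘ τ = ![a, b, c]} : ℝ)
      * msymmEval d (pvec d [a, b, c]) x
      = powerSum x a * powerSum x b * powerSum x c
      - powerSum x (a + b) * powerSum x c - powerSum x (a + c) * powerSum x b
      - powerSum x (b + c) * powerSum x a + 2 * powerSum x (a + b + c) := by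
  rw [← embSum_three]
  have hg : [a, b, c].get = ![a, b, c] := by ext s; fin_cases s <;> rfl
  have h := card_mul_msymmEval_pvec (d := d) [a, b, c] (by simp; omega)
    (by intro s; fin_cases s <;> simpa) x
  rwa [hg] at h

lemma msymmEval_fiveOne {d : ℕ} (hd : 2 ≤ d) (x : Fin (d + 1) → ℝ) :
    msymmEval d (pvec d [5, 1]) x = powerSum x 5 * powerSum x 1 - powerSum x 6 := by
  have h := card_mul_msymmEval_pair hd 5 1 (by simp) (by simp) x
  rwa [show #{τ : Equiv.Perm (Fin 2) | ![5, 1] ∘ τ = ![5, 1]} = 1 by decide, Nat.cast_one,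
    one_mul] at h

lemma msymmEval_fourTwo {d : ℕ} (hd : 2 ≤ d) (x : Fin (d + 1) → ℝ) :
    msymmEval d (pvec d [4, 2]) x = powerSum x 4 * powerSum x 2 - powerSum x 6 := by
  have h := card_mul_msymmEval_pair hd 4 2 (by simp) (by simp) x
  rwa [show #{τ : Equiv.Perm (Fin 2) | ![4, 2] ∘ τ = ![4, 2]} = 1 by decide, Nat.cast_one,
    one_mul] at h

lemma two_mul_msymmEval_threeThree {d : ℕ} (hd : 2 ≤ d) (x : Fin (d + 1) → ℝ) :
    2 * msymmEval d (pvec d [3, 3]) x = powerSum x 3 * powerSum x 3 - powerSum x 6 := by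
  have h := card_mul_msymmEval_pair hd 3 3 (by simp) (by simp) x
  rwa [show #{τ : Equiv.Perm (Fin 2) | ![3, 3] ∘ τ = ![3, 3]} = 2 by decide,
    Nat.cast_ofNat] at h

lemma msymmEval_threeTwoOne {d : ℕ} (hd : 2 ≤ d) (x : Fin (d + 1) → ℝ) :
    msymmEval d (pvec d [3, 2, 1]) x = powerSum x 3 * powerSum x 2 * powerSum x 1
      - powerSum x 5 * powerSum x 1 - powerSum x 4 * powerSum x 2
      - powerSum x 3 * powerSum x 3 + 2 * powerSum x 6 := by
  have h := card_mul_msymmEval_triple hd 3 2 1 (by simp) (by simp) (by simp) x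
  rwa [show #{τ : Equiv.Perm (Fin 3) | ![3, 2, 1] ∘ τ = ![3, 2, 1]} = 1 by decide, Nat.cast_one,
    one_mul] at h

lemma two_mul_msymmEval_fourOneOne {d : ℕ} (hd : 2 ≤ d) (x : Fin (d + 1) → ℝ) :
    2 * msymmEval d (pvec d [4, 1, 1]) x = powerSum x 4 * powerSum x 1 * powerSum x 1
      - powerSum x 5 * powerSum x 1 - powerSum x 5 * powerSum x 1
      - powerSum x 2 * powerSum x 4 + 2 * powerSum x 6 := by
  have h := card_mul_msymmEval_triple hd 4 1 1 (by simp) (by simp) (by simp) x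
  rwa [show #{τ : Equiv.Perm (Fin 3) | ![4, 1, 1] ∘ τ = ![4, 1, 1]} = 2 by decide,
    Nat.cast_ofNat] at h

lemma six_mul_msymmEval_twoTwoTwo {d : ℕ} (hd : 2 ≤ d) (x : Fin (d + 1) → ℝ) :
    6 * msymmEval d (pvec d [2, 2, 2]) x = powerSum x 2 * powerSum x 2 * powerSum x 2
      - powerSum x 4 * powerSum x 2 - powerSum x 4 * powerSum x 2
      - powerSum x 4 * powerSum x 2 + 2 * powerSum x 6 := by
  have h := card_mul_msymmEval_triple hd 2 2 2 (by simp) (by simp) (by simp) x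
  rwa [show #{τ : Equiv.Perm (Fin 3) | ![2, 2, 2] ∘ τ = ![2, 2, 2]} = 6 by decide,
    Nat.cast_ofNat] at h

lemma sum_ite_val_lt {n k : ℕ} (hk : k ≤ n) :
    ∑ i : Fin n, (if (i : ℕ) < k then (1 : ℝ) else 0) = k := by
  rw [Fin.sum_univ_eq_sum_range (fun i => if i < k then (1 : ℝ) else 0), ← Finset.sum_filter]
  rw [show (range n).filter (· < k) = range k by ext; simp; omega]
  simp

lemma powerSum_vk {d k n : ℕ} (hk : k ≤ d + 1) (hn : n ≠ 0) : powerSum (vk d k) n = k := by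
  rw [← sum_ite_val_lt hk]
  refine sum_congr rfl fun i _ => ?_
  unfold vk
  split_ifs <;> simp [hn]

lemma powerSum_uap {d p n : ℕ} (a : ℝ) (hp : p ≤ d) (hn : n ≠ 0) :
    powerSum (uap d a p) n = a ^ n + p := by
  rw [powerSum, Fin.sum_univ_succ, ← sum_ite_val_lt hp]
  refine congrArg₂ (· + ·) (by simp [uap]) (sum_congr rfl fun i _ => ?_)
  simp only [uap, Fin.val_succ, Nat.succ_le_iff]
  split_ifs <;> simp_all

lemma msymmEval_comp_perm {d : ℕ} (lv : Fin (d + 1) → ℕ) (x : Fin (d + 1) → ℝ)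
    (σ : Equiv.Perm (Fin (d + 1))) : msymmEval d lv (x ∘ σ) = msymmEval d lv x := by
  unfold msymmEval
  refine Finset.sum_nbij' (fun β => β ∘ σ.symm) (fun β => β ∘ σ) ?_ ?_ ?_ ?_ ?_
  · intro β hβ
    obtain ⟨τ, -, rfl⟩ := mem_image.1 hβ
    exact mem_image.2 ⟨σ.symm.trans τ, mem_univ _, rfl⟩
  · intro β hβ
    obtain ⟨τ, -, rfl⟩ := mem_image.1 hβ
    exact mem_image.2 ⟨σ.trans τ, mem_univ _, rfl⟩
  · intro β _
    ext i
    simp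
  · intro β _
    ext i
    simp
  · intro β _
    rw [← Equiv.prod_comp σ fun i => x i ^ (β ∘ σ.symm) i]
    simp

lemma orbitAvg_eq_of_invariant {d : ℕ} (y : Fin (d + 1) → ℝ) (f : (Fin (d + 1) → ℝ) → ℝ)
    (hf : ∀ σ : Equiv.Perm (Fin (d + 1)), f (y ∘ σ) = f y) : orbitAvg d y f = f y := by
  unfold orbitAvg
  have hconst : ∀ z ∈ univ.image (fun σ : Equiv.Perm (Fin (d + 1)) => y ∘ σ), f z = f y := by
    intro z hz
    obtain ⟨σ, -, rfl⟩ := mem_image.1 hz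
    exact hf σ
  have hcard : (#(univ.image (fun σ : Equiv.Perm (Fin (d + 1)) => y ∘ σ)) : ℝ) ≠ 0 := by
    rw [Nat.cast_ne_zero, Finset.card_ne_zero]
    exact univ_nonempty.image _
  rw [Finset.sum_congr rfl hconst, Finset.sum_const, nsmul_eq_mul, inv_mul_cancel_left₀ hcard]

/-- The monomial symmetric polynomial with exponent vector `lv`. -/
noncomputable def msymmPoly (d : ℕ) (lv : Fin (d + 1) → ℕ) : MvPolynomial (Fin (d + 1)) ℝ :=
  ∑ β ∈ univ.image (fun σ : Equiv.Perm (Fin (d + 1)) => lv ∘ σ), ∏ i, MvPolynomial.X i ^ β i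

lemma eval_msymmPoly {d : ℕ} (lv : Fin (d + 1) → ℕ) (x : Fin (d + 1) → ℝ) :
    MvPolynomial.eval x (msymmPoly d lv) = msymmEval d lv x := by
  simp [msymmPoly, msymmEval]

lemma isHomogeneous_msymmPoly {d : ℕ} (lv : Fin (d + 1) → ℕ) :
    (msymmPoly d lv).IsHomogeneous (∑ i, lv i) := by
  refine MvPolynomial.IsHomogeneous.sum _ _ _ fun β hβ => ?_
  obtain ⟨σ, -, rfl⟩ := mem_image.1 hβ
  rw [← Equiv.sum_comp σ lv]
  exact MvPolynomial.IsHomogeneous.prod _ _ _ fun i _ => MvPolynomial.isHomogeneous_X_pow i _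

lemma sum_pvec {d : ℕ} (l : List ℕ) (hl : l.length ≤ d + 1) : ∑ i, pvec d l i = l.sum := by
  obtain ⟨c, hc⟩ := Nat.exists_eq_add_of_le hl
  simp only [pvec]
  rw [Fin.sum_univ_eq_sum_range (fun i => l.getD i 0), hc, Finset.sum_range_add,
    ← Fin.sum_univ_eq_sum_range, ← Fin.sum_univ_getElem]
  simp

/-- Necessary relations for a cubature rule of index `6` of the considered form. -/
theorem cubature_index_six_relations
    (d : ℕ) (hd : 2 ≤ d) (γ : ℝ) (hγ : -1 < γ)
    (q : ℕ) (hq : 1 ≤ q)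
    (k : Fin q → ℕ) (hkinj : Function.Injective k)
    (hk1 : ∀ j, 1 ≤ k j) (hkd : ∀ j, k j ≤ d + 1)
    (p : ℕ) (hp1 : 2 ≤ p) (hpd : p ≤ d)
    (a : ℝ) (ha : 0 < a) (ha1 : a ≠ 1)
    (A : Fin q → ℝ) (Aq1 : ℝ)
    (hcub : ∀ f : MvPolynomial (Fin (d + 1)) ℝ, f.IsHomogeneous 6 →
      wg d γ * ∫ x in Td d, MvPolynomial.eval (lift d x) f * Wg d γ x
        = (∑ j, A j * orbitAvg d (vk d (k j)) (fun z => MvPolynomial.eval z f))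
          + Aq1 * orbitAvg d (uap d a p) (fun z => MvPolynomial.eval z f)) :
    (p : ℝ) * Aq1 * a * (a - 1) ^ 2 * (a + 1) ^ 2
        = momentS d γ (pvec d [5, 1]) - 2 * momentS d γ (pvec d [3, 3])
    ∧ (p : ℝ) * Aq1 * a ^ 2 * (a - 1) ^ 2
        = momentS d γ (pvec d [4, 2]) - 2 * momentS d γ (pvec d [3, 3])
    ∧ -2 * Aq1 * a * (a - 1) ^ 2 * (a + 1) * ((p : ℝ) * ((p : ℝ) - 1) / 2)
        = momentS d γ (pvec d [3, 2, 1]) - 2 * momentS d γ (pvec d [4, 1, 1])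
    ∧ 2 * Aq1 * a * (a - 1) ^ 2 * ((p : ℝ) * ((p : ℝ) - 1) / 2)
        = momentS d γ (pvec d [3, 2, 1]) - 6 * momentS d γ (pvec d [2, 2, 2]) := by
  have hmom (lv : Fin (d + 1) → ℕ) (hlv : ∑ i, lv i = 6) :
      momentS d γ lv = ∑ j, A j * msymmEval d lv (vk d (k j))
        + Aq1 * msymmEval d lv (uap d a p) := by
    have h := hcub (msymmPoly d lv) (hlv ▸ isHomogeneous_msymmPoly lv)
    simp only [eval_msymmPoly] at h
    simp only [orbitAvg_eq_of_invariant _ _ (msymmEval_comp_perm lv _)] at h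
    exact h
  have hdiff (l l' : List ℕ) (c : ℝ) (hl : l.length ≤ d + 1) (hl' : l'.length ≤ d + 1)
      (hs : l.sum = 6) (hs' : l'.sum = 6)
      (hv : ∀ j, msymmEval d (pvec d l) (vk d (k j)) = c * msymmEval d (pvec d l') (vk d (k j))) :
      momentS d γ (pvec d l) - c * momentS d γ (pvec d l')
        = Aq1 * (msymmEval d (pvec d l) (uap d a p)
          - c * msymmEval d (pvec d l') (uap d a p)) := by
    rw [hmom _ ((sum_pvec l hl).trans hs), hmom _ ((sum_pvec l' hl').trans hs')]
    have : ∑ j, A j * msymmEval d (pvec d l) (vk d (k j))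
        = c * ∑ j, A j * msymmEval d (pvec d l') (vk d (k j)) := by
      rw [Finset.mul_sum]
      exact sum_congr rfl fun j _ => by rw [hv]; ring
    rw [this]
    ring
  have hpv (j : Fin q) (n : ℕ) (hn : n ≠ 0) : powerSum (vk d (k j)) n = k j :=
    powerSum_vk (hkd j) hn
  have hpu (n : ℕ) (hn : n ≠ 0) : powerSum (uap d a p) n = a ^ n + p := powerSum_uap a hpd hn
  refine ⟨?_, ?_, ?_, ?_⟩
  · rw [hdiff [5, 1] [3, 3] 2 (by simp; omega) (by simp; omega) rfl rfl fun j => by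
        rw [msymmEval_fiveOne hd, two_mul_msymmEval_threeThree hd]; simp [hpv],
      msymmEval_fiveOne hd, two_mul_msymmEval_threeThree hd]
    simp only [hpu, ne_eq, OfNat.ofNat_ne_zero, one_ne_zero, not_false_eq_true]
    ring
  · rw [hdiff [4, 2] [3, 3] 2 (by simp; omega) (by simp; omega) rfl rfl fun j => by
        rw [msymmEval_fourTwo hd, two_mul_msymmEval_threeThree hd]; simp [hpv],
      msymmEval_fourTwo hd, two_mul_msymmEval_threeThree hd]
    simp only [hpu, ne_eq, OfNat.ofNat_ne_zero, not_false_eq_true]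
    ring
  · rw [hdiff [3, 2, 1] [4, 1, 1] 2 (by simp; omega) (by simp; omega) rfl rfl fun j => by
        rw [msymmEval_threeTwoOne hd, two_mul_msymmEval_fourOneOne hd]; simp [hpv],
      msymmEval_threeTwoOne hd, two_mul_msymmEval_fourOneOne hd]
    simp only [hpu, ne_eq, OfNat.ofNat_ne_zero, one_ne_zero, not_false_eq_true]
    ring
  · rw [hdiff [3, 2, 1] [2, 2, 2] 6 (by simp; omega) (by simp; omega) rfl rfl fun j => by
        rw [msymmEval_threeTwoOne hd, six_mul_msymmEval_twoTwoTwo hd]; simp [hpv],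
      msymmEval_threeTwoOne hd, six_mul_msymmEval_twoTwoTwo hd]
    simp only [hpu, ne_eq, OfNat.ofNat_ne_zero, one_ne_zero, not_false_eq_true]
    ring
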